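/- arXiv:2111.04536 — 2 statements merged into one kernel-verified Lean document; each statement's English description precedes it below -/
import Mathlib

section
/- Let ι be a finite index type, and let m̄, φ, m : ι → ℕ satisfy m i ≤ φ i for all i. Let S := {i ∈ ι : m̄ i > 0} (as a finite set), and assume S is nonempty. Then the following are equivalent: (a) there exists κ : ι → ℕ with κ i ≤ 1 for all i, such that (m i : ℤ) − (φ i + 1)·(κ i) ≤ (m̄ i : ℤ) − 1 for every i ∈ S, and ∑_{i ∈ S} κ i ≤ |S| − 1; (b) there exists i ∈ S with m i < m̄ i. In particular, the cut system (a) is violated by a vector m exactly when m i ≥ m̄ i for every i ∈ S, so the feasibility cut removes the infeasible candidate m̄ together with every solution dominating it componentwise on S. -/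
/-- Validity of the LBBD feasibility cuts: the cut system is satisfiable for `m`
exactly when `m i < m̄ i` for some site pair `i` in the support `S` of `m̄`;
so the cut removes `m̄` together with every solution dominating it on `S`. -/
theorem lbbd_feasibility_cut_valid
    {ι : Type*} [Fintype ι] [DecidableEq ι]
    (mbar φ m : ι → ℕ) (hmφ : ∀ i, m i ≤ φ i)
    (S : Finset ι) (hS : S = Finset.univ.filter (fun i => 0 < mbar i))
    (hSne : S.Nonempty) :
    ((∃ κ : ι → ℕ, (∀ i, κ i ≤ 1) ∧
        (∀ i ∈ S, (m i : ℤ) - ((φ i : ℤ) + 1) * (κ i : ℤ) ≤ (mbar i : ℤ) - 1) ∧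
        ∑ i ∈ S, κ i ≤ S.card - 1) ↔
      ∃ i ∈ S, m i < mbar i) := by
  constructor
  · rintro ⟨κ, -, hcut, hsum⟩
    by_contra! hdom
    have hκ : ∀ i ∈ S, 1 ≤ κ i := by
      intro i hi
      by_contra! h0
      have hi_cut := hcut i hi
      have hi_dom := hdom i hi
      have h0 : κ i = 0 := by omega
      simp only [h0, Nat.cast_zero, mul_zero] at hi_cut
      omega
    have hcard : S.card ≤ ∑ i ∈ S, κ i := by
      simpa using S.card_nsmul_le_sum κ 1 hκ
    have hpos := hSne.card_pos
    omega
  · rintro ⟨j, hj, hlt⟩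
    refine ⟨fun i => if m i < mbar i then 0 else 1, fun i => ?_, fun i _ => ?_, ?_⟩
    · dsimp only
      split_ifs <;> omega
    · have hi := hmφ i
      dsimp only
      split_ifs <;> push_cast <;> omega
    · refine Nat.le_sub_one_of_lt ?_
      rw [Finset.card_eq_sum_ones]
      refine Finset.sum_lt_sum (fun i _ => ?_) ⟨j, hj, by simp [hlt]⟩
      split_ifs <;> omega
end

section
/- Let ι be a finite index type, m̄, φ : ι → ℕ with m̄ i ≤ φ i for all i, and let S := {i ∈ ι : m̄ i > 0} (as a finite set). Let Q : (ι → ℕ) → ℝ be nondecreasing (if a i ≤ b i for all i then Q a ≤ Q b) and nonnegative (Q a ≥ 0 for all a). Then for every m : ι → ℕ with m i ≤ φ i for all i and every real η with η ≥ Q m, there exists κ : ι → ℕ with κ i ≤ 1 for all i such that (m i : ℤ) − (φ i + 1)·(κ i) ≤ (m̄ i : ℤ) − 1 for every i ∈ S, and η ≥ Q m̄ · (1 − ∑_{i ∈ S} (1 − κ i)). That is, every pair (η, m) with η at least the true subproblem cost Q m satisfies the LBBD optimality cut for a suitable choice of the binary variables κ. -/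
/-- Validity of the LBBD optimality cuts: every pair `(η, m)` with `η ≥ Q m` (the true
subproblem cost, a nonnegative nondecreasing function) satisfies the optimality cut for
a suitable choice of the binary variables `κ`. -/
theorem lbbd_optimality_cut_valid
    {ι : Type*} [Fintype ι] [DecidableEq ι]
    (mbar φ : ι → ℕ) (hmbarφ : ∀ i, mbar i ≤ φ i)
    (S : Finset ι) (hS : S = Finset.univ.filter (fun i => 0 < mbar i))
    (Q : (ι → ℕ) → ℝ)
    (hQmono : ∀ a b : ι → ℕ, (∀ i, a i ≤ b i) → Q a ≤ Q b)
    (hQnonneg : ∀ a : ι → ℕ, 0 ≤ Q a) :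
    ∀ m : ι → ℕ, (∀ i, m i ≤ φ i) → ∀ η : ℝ, Q m ≤ η →
      ∃ κ : ι → ℕ, (∀ i, κ i ≤ 1) ∧
        (∀ i ∈ S, (m i : ℤ) - ((φ i : ℤ) + 1) * (κ i : ℤ) ≤ (mbar i : ℤ) - 1) ∧
        Q mbar * (1 - ∑ i ∈ S, (1 - (κ i : ℝ))) ≤ η := by
  intro m hm η hη
  refine ⟨fun i => if mbar i ≤ m i then 1 else 0, fun i => ?_, fun i _ => ?_, ?_⟩
  · dsimp only
    split_ifs <;> simp
  · have := hm i
    dsimp only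
    split_ifs <;> push_cast <;> omega
  · have hterm : ∀ i ∈ S, (0 : ℝ) ≤ 1 - ((if mbar i ≤ m i then 1 else 0 : ℕ) : ℝ) := by
      intro i _
      split_ifs <;> simp
    by_cases h : ∀ i ∈ S, mbar i ≤ m i
    · have hle : ∀ i, mbar i ≤ m i := by
        intro i
        rcases Nat.eq_zero_or_pos (mbar i) with h0 | hpos
        · omega
        · exact h i (by simp [hS, hpos])
      have hsum := Finset.sum_nonneg hterm
      have hQ := hQmono mbar m hle
      nlinarith [hQnonneg mbar]
    · push Not at h
      obtain ⟨j, hjS, hj⟩ := h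
      have hsum := Finset.single_le_sum hterm hjS
      rw [if_neg (not_le.mpr hj)] at hsum
      push_cast at hsum ⊢
      nlinarith [hQnonneg mbar, hQnonneg m]
end
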